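/- arXiv:2412.16862 — 10 statements merged into one kernel-verified Lean document; each statement's English description precedes it below -/
import Mathlib

section
/- Let x₀, c be real numbers with 0 ≤ c ≤ x₀ ≤ 1/2, and define a sequence by x_{j+1} = (x_j + 2c(1−c))/(3 − 2x_j). Then x_j ∈ [c, 1/2] for all j, the sequence is non-increasing, and x_j converges to c as j → ∞. -/
/-- The rational map ξ ↦ (ξ + 2c(1−c))/(3 − 2ξ): starting from x₀ with
0 ≤ c ≤ x₀ ≤ 1/2, the iterates stay in [c, 1/2], are non-increasing,
and converge to c. -/
theorem cube_rational_map_dynamics (x₀ c : ℝ) (hc : 0 ≤ c) (hcx : c ≤ x₀)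
    (hx : x₀ ≤ 1 / 2) (x : ℕ → ℝ) (hx0 : x 0 = x₀)
    (hrec : ∀ j, x (j + 1) = (x j + 2 * c * (1 - c)) / (3 - 2 * x j)) :
    (∀ j, x j ∈ Set.Icc c (1 / 2)) ∧ (∀ j, x (j + 1) ≤ x j) ∧
      Filter.Tendsto x Filter.atTop (nhds c) := by
  have hmul (j : ℕ) (hj : x j ≤ 1 / 2) :
      x (j + 1) * (3 - 2 * x j) = x j + 2 * c * (1 - c) := by
    rw [hrec, div_mul_cancel₀ _ (by linarith)]
  have hstep (j : ℕ) (hj : x j ∈ Set.Icc c (1 / 2)) : c ≤ x (j + 1) ∧ x (j + 1) ≤ x j := by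
    obtain ⟨h1, h2⟩ := hj
    have hpos : 0 < 3 - 2 * x j := by linarith
    rw [hrec, le_div_iff₀ hpos, div_le_iff₀ hpos]
    constructor
    · nlinarith [mul_nonneg (sub_nonneg.2 h1) hc]
    · nlinarith [mul_nonneg (sub_nonneg.2 h1) (by linarith : 0 ≤ 1 - c - x j)]
  have hmem (j : ℕ) : x j ∈ Set.Icc c (1 / 2) := by
    induction j with
    | zero => exact hx0 ▸ ⟨hcx, hx⟩
    | succ j ih => exact ⟨(hstep j ih).1, (hstep j ih).2.trans ih.2⟩
  have hanti (j : ℕ) : x (j + 1) ≤ x j := (hstep j (hmem j)).2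
  refine ⟨hmem, hanti, ?_⟩
  have hlim := tendsto_atTop_ciInf (antitone_nat_of_succ_le hanti)
    ⟨c, Set.forall_mem_range.2 fun j => (hmem j).1⟩
  generalize ⨅ j, x j = L at hlim
  obtain ⟨hcL, hL⟩ : L ∈ Set.Icc c (1 / 2) :=
    isClosed_Icc.mem_of_tendsto hlim (Filter.Eventually.of_forall hmem)
  have hfix : L * (3 - 2 * L) = L + 2 * c * (1 - c) :=
    tendsto_nhds_unique
      (((hlim.comp (Filter.tendsto_add_atTop_nat 1)).mul
        ((hlim.const_mul 2).const_sub 3)).congr fun j => hmul j (hmem j).2)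
      (hlim.add_const _)
  have hprod : (L - c) * (L - (1 - c)) = 0 := by linarith
  have hLc : L = c := by
    rcases mul_eq_zero.1 hprod with h | h <;> linarith
  exact hLc ▸ hlim
end

section
/- For all real numbers a, b with 0 ≤ b ≤ a < 1/2, the point z = (1 − (a + 2b(1−b))/(3 − 2a), 1 − b) in ℝ² is equidistant from the three points p_F = (a, −1−b), p_R = (3−a, b), p_B = (a, 3−b), i.e., |z − p_F| = |z − p_R| = |z − p_B|. -/
/-- The point (x, y) of the Euclidean plane. -/
noncomputable def pt2 (x y : ℝ) : EuclideanSpace ℝ (Fin 2) :=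
  (WithLp.equiv 2 (Fin 2 → ℝ)).symm ![x, y]

theorem dist_pt2 (x y u v : ℝ) :
    dist (pt2 x y) (pt2 u v) = √((x - u) ^ 2 + (y - v) ^ 2) := by
  simp [pt2, EuclideanSpace.dist_eq, Fin.sum_univ_two, Real.dist_eq, sq_abs]

/-- The farthest point on the 3-cube: the point
(1 − (a + 2b(1−b))/(3 − 2a), 1 − b) is equidistant from the three source
images p_F = (a, −1−b), p_R = (3−a, b), p_B = (a, 3−b). -/
theorem cube3_circumcenter (a b : ℝ) (hb : 0 ≤ b) (hba : b ≤ a) (ha : a < 1 / 2) :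
    dist (pt2 (1 - (a + 2 * b * (1 - b)) / (3 - 2 * a)) (1 - b)) (pt2 a (-1 - b)) =
        dist (pt2 (1 - (a + 2 * b * (1 - b)) / (3 - 2 * a)) (1 - b)) (pt2 (3 - a) b) ∧
      dist (pt2 (1 - (a + 2 * b * (1 - b)) / (3 - 2 * a)) (1 - b)) (pt2 (3 - a) b) =
        dist (pt2 (1 - (a + 2 * b * (1 - b)) / (3 - 2 * a)) (1 - b)) (pt2 a (3 - b)) := by
  have h : 3 - 2 * a ≠ 0 := by linarith
  have hq := div_mul_cancel₀ (a + 2 * b * (1 - b)) h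
  simp only [dist_pt2]
  constructor <;> congr 1
  · linear_combination -2 * hq
  · linear_combination 2 * hq
end

section
/- For all real a, c with 0 ≤ c ≤ a ≤ 1/2, each of the following six points of ℝ² is equidistant from q_U = (a, 3−c), q_D = (a, −1−c), and the indicated third point: (i) ((1+c)(1−a−c)/(1+a−c), 1−c) is equidistant from q_U, q_D, q_UL = (−1+c, 2+a); (ii) (−1/2 + (3−2c)(1+2c)/(2+4a), 1−c) is equidistant from q_U, q_D, q_L = (−1−a, c); (iii) ((1−a+c)(1−c)/(1+a+c), 1−c) is equidistant from q_U, q_D, q_LD = (−1−c, −a); (iv) (1 − (1+c)(a−c)/(2−a−c), 1−c) is equidistant from q_U, q_D, q_UR = (2−c, 3−a); (v) (3/2 − (3−2c)(1+2c)/(2(3−2a)), 1−c) is equidistant from q_U, q_D, q_R = (3−a, c); (vi) (1 − (a+c)(1−c)/(2−a+c), 1−c) is equidistant from q_U, q_D, q_RD = (2+c, −1+a). -/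
/-- A point `w` is equidistant from points `p q r`. -/
def Equidist (w p q r : EuclideanSpace ℝ (Fin 2)) : Prop :=
  dist w p = dist w q ∧ dist w q = dist w r

theorem dist_pt2_eq_dist_pt2_iff {x y x₁ y₁ x₂ y₂ : ℝ} :
    dist (pt2 x y) (pt2 x₁ y₁) = dist (pt2 x y) (pt2 x₂ y₂) ↔
      (x - x₁) ^ 2 + (y - y₁) ^ 2 = (x - x₂) ^ 2 + (y - y₂) ^ 2 := by
  simp only [EuclideanSpace.dist_eq, Fin.sum_univ_two, Real.dist_eq, sq_abs]
  exact Real.sqrt_inj (by positivity) (by positivity)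

theorem equidist_pt2_iff {a c w x y : ℝ} :
    Equidist (pt2 w (1 - c)) (pt2 a (3 - c)) (pt2 a (-1 - c)) (pt2 x y) ↔
      (w - a) ^ 2 + 4 = (w - x) ^ 2 + (1 - c - y) ^ 2 := by
  rw [Equidist, dist_pt2_eq_dist_pt2_iff, dist_pt2_eq_dist_pt2_iff]
  constructor
  · rintro ⟨-, h⟩
    linarith
  · intro h
    constructor <;> linarith

/-- Circumcenters of the triangles (q_U, q_D, q_F) for the six projected source
images F ∈ {UL, L, LD, UR, R, RD}; each lies on the line z = 1−c. -/
theorem circumcenters_UD (a c : ℝ) (hc : 0 ≤ c) (hca : c ≤ a) (ha : a ≤ 1 / 2) :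
    Equidist (pt2 ((1 + c) * (1 - a - c) / (1 + a - c)) (1 - c))
        (pt2 a (3 - c)) (pt2 a (-1 - c)) (pt2 (-1 + c) (2 + a)) ∧
      Equidist (pt2 (-1 / 2 + (3 - 2 * c) * (1 + 2 * c) / (2 + 4 * a)) (1 - c))
        (pt2 a (3 - c)) (pt2 a (-1 - c)) (pt2 (-1 - a) c) ∧
      Equidist (pt2 ((1 - a + c) * (1 - c) / (1 + a + c)) (1 - c))
        (pt2 a (3 - c)) (pt2 a (-1 - c)) (pt2 (-1 - c) (-a)) ∧
      Equidist (pt2 (1 - (1 + c) * (a - c) / (2 - a - c)) (1 - c))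
        (pt2 a (3 - c)) (pt2 a (-1 - c)) (pt2 (2 - c) (3 - a)) ∧
      Equidist (pt2 (3 / 2 - (3 - 2 * c) * (1 + 2 * c) / (2 * (3 - 2 * a))) (1 - c))
        (pt2 a (3 - c)) (pt2 a (-1 - c)) (pt2 (3 - a) c) ∧
      Equidist (pt2 (1 - (a + c) * (1 - c) / (2 - a + c)) (1 - c))
        (pt2 a (3 - c)) (pt2 a (-1 - c)) (pt2 (2 + c) (-1 + a)) := by
  have h₁ : 1 + a - c ≠ 0 := (by linarith : (0 : ℝ) < _).ne'
  have h₂ : 2 + 4 * a ≠ 0 := (by linarith : (0 : ℝ) < _).ne'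
  have h₃ : 1 + a + c ≠ 0 := (by linarith : (0 : ℝ) < _).ne'
  have h₄ : 2 - a - c ≠ 0 := (by linarith : (0 : ℝ) < _).ne'
  have h₅ : 3 - 2 * a ≠ 0 := (by linarith : (0 : ℝ) < _).ne'
  have h₆ : 2 - a + c ≠ 0 := (by linarith : (0 : ℝ) < _).ne'
  simp only [equidist_pt2_iff]
  refine ⟨?_, ?_, ?_, ?_, ?_, ?_⟩ <;> field_simp <;> ring
end

section
/- For all real a, c with 0 ≤ c ≤ a ≤ 1/2, the following inequalities hold: (1+c)(1−a−c)/(1+a−c) ≤ 1−a, −1/2 + (3−2c)(1+2c)/(2+4a) ≤ 1−a, (1−a+c)(1−c)/(1+a+c) ≤ 1−a, and 1−a ≤ 1 − (1+c)(a−c)/(2−a−c), 1−a ≤ 3/2 − (3−2c)(1+2c)/(2(3−2a)), 1−a ≤ 1 − (a+c)(1−c)/(2−a+c). -/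
/-- Comparison of the x-coordinates of the six circumcenters with 1−a:
the three `left' circumcenters are at most 1−a and the three `right' ones
are at least 1−a. -/
theorem circumcenter_x_comparisons (a c : ℝ) (hc : 0 ≤ c) (hca : c ≤ a)
    (ha : a ≤ 1 / 2) :
    (1 + c) * (1 - a - c) / (1 + a - c) ≤ 1 - a ∧
      -1 / 2 + (3 - 2 * c) * (1 + 2 * c) / (2 + 4 * a) ≤ 1 - a ∧
      (1 - a + c) * (1 - c) / (1 + a + c) ≤ 1 - a ∧
      1 - a ≤ 1 - (1 + c) * (a - c) / (2 - a - c) ∧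
      1 - a ≤ 3 / 2 - (3 - 2 * c) * (1 + 2 * c) / (2 * (3 - 2 * a)) ∧
      1 - a ≤ 1 - (a + c) * (1 - c) / (2 - a + c) := by
  have hsum : 0 ≤ 1 - a - c := by linarith
  have hac : 0 ≤ a * c := mul_nonneg (hc.trans hca) hc
  have hdiff : 0 ≤ (a - c) * (1 - a - c) := mul_nonneg (by linarith) hsum
  have hleft : 0 ≤ a * (1 - a - c) := mul_nonneg (hc.trans hca) hsum
  have hright : 0 ≤ c * (1 - a) := mul_nonneg hc (by linarith)
  have hsq : 0 ≤ c ^ 2 := sq_nonneg c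
  have h₁ : (1 + c) * (1 - a - c) / (1 + a - c) ≤ 1 - a := by
    rw [div_le_iff₀ (by linarith)]
    linarith
  have h₂ : (3 - 2 * c) * (1 + 2 * c) / (2 + 4 * a) ≤ 3 / 2 - a := by
    rw [div_le_iff₀ (by linarith)]
    linarith
  have h₃ : (1 - a + c) * (1 - c) / (1 + a + c) ≤ 1 - a := by
    rw [div_le_iff₀ (by linarith)]
    linarith
  have h₄ : (1 + c) * (a - c) / (2 - a - c) ≤ a := by
    rw [div_le_iff₀ (by linarith)]
    linarith
  have h₅ : (3 - 2 * c) * (1 + 2 * c) / (2 * (3 - 2 * a)) ≤ 1 / 2 + a := by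
    rw [div_le_iff₀ (by linarith)]
    linarith
  have h₆ : (a + c) * (1 - c) / (2 - a + c) ≤ a := by
    rw [div_le_iff₀ (by linarith)]
    linarith
  exact ⟨h₁, by linarith, h₃, by linarith, by linarith, by linarith⟩
end

section
/- Let 0 ≤ c ≤ b ≤ a ≤ 1/2 and suppose ψ₁(a,c) = 8(−a + c + a² + 4ac + c² − 2a²c − 2c³) ≥ 0. Set w = (3/2 − (3−2c)(1+2c)/(2(3−2a)), 1−b, 1−c) ∈ ℝ³. Then |w − p_U| = |w − p_D| = |w − p_R|, and for every one of the 26 points p_F listed below, |w − p_F| ≥ |w − p_U|; i.e., the sphere centered at w through p_U, p_D, p_R contains none of the 26 points in its interior. -/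
/-- The point (x, y, z) of Euclidean 3-space. -/
noncomputable def pt3 (x y z : ℝ) : EuclideanSpace ℝ (Fin 3) :=
  (WithLp.equiv 2 (Fin 3 → ℝ)).symm ![x, y, z]

/-- ψ₁(a,c) = 8(−a + c + a² + 4ac + c² − 2a²c − 2c³). -/
noncomputable def psi1 (a c : ℝ) : ℝ :=
  8 * (-a + c + a ^ 2 + 4 * a * c + c ^ 2 - 2 * a ^ 2 * c - 2 * c ^ 3)

theorem dist_pt3 (x y z x' y' z' : ℝ) :
    dist (pt3 x y z) (pt3 x' y' z') = √((x - x') ^ 2 + (y - y') ^ 2 + (z - z') ^ 2) := by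
  simp [pt3, EuclideanSpace.dist_eq, Fin.sum_univ_three, Real.dist_eq, sq_abs]

/-- The empty-sphere inequality for a single point, with the denominator `3 - 2 * a` of the
center cleared. -/
theorem dist_center_le {a b c x y z : ℝ} (ha : a ≤ 1 / 2)
    (h : 0 ≤ (x ^ 2 - a ^ 2 + (1 - b - y) ^ 2 + (1 - c - z) ^ 2 - (1 - 2 * b) ^ 2 - 4
      + 3 * (a - x)) * (3 - 2 * a) - (a - x) * ((3 - 2 * c) * (1 + 2 * c))) :
    dist (pt3 (3 / 2 - (3 - 2 * c) * (1 + 2 * c) / (2 * (3 - 2 * a))) (1 - b) (1 - c))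
        (pt3 a b (3 - c)) ≤
      dist (pt3 (3 / 2 - (3 - 2 * c) * (1 + 2 * c) / (2 * (3 - 2 * a))) (1 - b) (1 - c))
        (pt3 x y z) := by
  have hpos : 0 < 3 - 2 * a := by linarith
  have hne := hpos.ne'
  rw [dist_pt3, dist_pt3]
  apply Real.sqrt_le_sqrt
  rw [← sub_nonneg]
  set e := (3 - 2 * c) * (1 + 2 * c) / (2 * (3 - 2 * a)) with he
  have h2 : (3 - 2 * c) * (1 + 2 * c) = 2 * e * (3 - 2 * a) := by
    rw [he]
    field_simp
  rw [h2] at h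
  refine nonneg_of_mul_nonneg_left (h.trans_eq ?_) hpos
  ring

/-- Empty-sphere property of the triangle (p_U, p_D, p_R) when ψ₁(a,c) ≥ 0:
the sphere centered at w = (3/2 − (3−2c)(1+2c)/(2(3−2a)), 1−b, 1−c) passing
through p_U, p_D, p_R contains none of the 26 source images in its interior. -/
theorem UDR_empty_sphere (a b c : ℝ) (hc : 0 ≤ c) (hcb : c ≤ b) (hba : b ≤ a)
    (ha : a ≤ 1 / 2) (hpsi : 0 ≤ psi1 a c) :
    dist (pt3 (3 / 2 - (3 - 2 * c) * (1 + 2 * c) / (2 * (3 - 2 * a))) (1 - b) (1 - c))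
          (pt3 a b (3 - c)) =
        dist (pt3 (3 / 2 - (3 - 2 * c) * (1 + 2 * c) / (2 * (3 - 2 * a))) (1 - b) (1 - c))
          (pt3 a b (-1 - c)) ∧
      dist (pt3 (3 / 2 - (3 - 2 * c) * (1 + 2 * c) / (2 * (3 - 2 * a))) (1 - b) (1 - c))
          (pt3 a b (-1 - c)) =
        dist (pt3 (3 / 2 - (3 - 2 * c) * (1 + 2 * c) / (2 * (3 - 2 * a))) (1 - b) (1 - c))
          (pt3 (3 - a) b c) ∧
      (∀ q ∈ ({pt3 a b (3 - c), pt3 a b (-1 - c),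
          pt3 a (-1 + c) (2 + b), pt3 a (-1 - b) c, pt3 a (-1 - c) (-b),
          pt3 a (2 - c) (3 - b), pt3 a (3 - b) c, pt3 a (2 + c) (-1 + b),
          pt3 (-1 + c) b (2 + a), pt3 (-1 - a) b c, pt3 (-1 - c) b (-a),
          pt3 (2 - c) b (3 - a), pt3 (3 - a) b c, pt3 (2 + c) b (-1 + a),
          pt3 (-1 + c) (-a) (2 + b), pt3 (-1 - b) (-a) c, pt3 (-1 - c) (-a) (-b),
          pt3 (2 - c) (-1 + a) (2 + b), pt3 (2 + b) (-1 + a) c,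
          pt3 (2 + c) (-1 + a) (-b),
          pt3 (-1 + b) (2 - c) (2 + a), pt3 (-1 + b) (2 + a) c,
          pt3 (-1 + b) (2 + c) (-a),
          pt3 (2 - b) (2 - c) (3 - a), pt3 (2 - b) (3 - a) c,
          pt3 (2 - b) (2 + c) (-1 + a)} : Set (EuclideanSpace ℝ (Fin 3))),
        dist (pt3 (3 / 2 - (3 - 2 * c) * (1 + 2 * c) / (2 * (3 - 2 * a))) (1 - b) (1 - c))
            (pt3 a b (3 - c)) ≤
          dist (pt3 (3 / 2 - (3 - 2 * c) * (1 + 2 * c) / (2 * (3 - 2 * a))) (1 - b) (1 - c))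
            q) := by
  have hpos : 0 < 3 - 2 * a := by linarith
  have hψ : 0 ≤ -a + c + a ^ 2 + 4 * a * c + c ^ 2 - 2 * a ^ 2 * c - 2 * c ^ 3 := by
    unfold psi1 at hpsi
    linarith
  have hb : 0 ≤ b := hc.trans hcb
  have ha0 : 0 ≤ a := hb.trans hba
  have hcb' : 0 ≤ b - c := sub_nonneg.2 hcb
  have hba' : 0 ≤ a - b := sub_nonneg.2 hba
  have ha' : 0 ≤ 1 - 2 * a := by linarith
  refine ⟨?_, ?_, ?_⟩
  · rw [dist_pt3, dist_pt3]
    congr 1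
    ring
  · have hne := hpos.ne'
    rw [dist_pt3, dist_pt3]
    congr 1
    field_simp
    ring
  have hRF : 0 ≤ (b - c) * (6 - 6 * (b + c) + 4 * a * (1 - a) + 4 * c * (1 - c)
      + 4 * a * (b + c)) :=
    mul_nonneg hcb' (by nlinarith [mul_nonneg ha0 hb, mul_nonneg ha0 hc])
  have hBR : 0 ≤ (b - c) * (18 - 6 * (b + c) - 20 * a + 4 * a * (b + c) + 4 * a ^ 2 - 4 * c
      + 4 * c ^ 2) :=
    mul_nonneg hcb' (by nlinarith [mul_nonneg ha0 hb, mul_nonneg ha0 hc])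
  have hdiag : 0 ≤ c * ((1 - 2 * a) * (5 / 2 - a) + (1 - 2 * c) ^ 2 / 2) :=
    mul_nonneg hc (add_nonneg (mul_nonneg ha' (by linarith)) (by positivity))
  have hcc := mul_nonneg hc hc
  have hcp := mul_nonneg hc hcb'
  have hcq := mul_nonneg hc hba'
  have hcr := mul_nonneg hc ha'
  have hpp := mul_nonneg hcb' hcb'
  have hpq := mul_nonneg hcb' hba'
  have hpr := mul_nonneg hcb' ha'
  have hqq := mul_nonneg hba' hba'
  have hqr := mul_nonneg hba' ha'
  have hccc := mul_nonneg hcc hc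
  have hccp := mul_nonneg hcc hcb'
  have hccq := mul_nonneg hcc hba'
  have hccr := mul_nonneg hcc ha'
  have hcpp := mul_nonneg hcp hcb'
  have hcpq := mul_nonneg hcp hba'
  have hcpr := mul_nonneg hcp ha'
  have hcqq := mul_nonneg hcq hba'
  have hcqr := mul_nonneg hcq ha'
  have hcrr := mul_nonneg hcr ha'
  have hppp := mul_nonneg hpp hcb'
  have hppq := mul_nonneg hpp hba'
  have hppr := mul_nonneg hpp ha'
  have hpqq := mul_nonneg hpq hba'
  have hpqr := mul_nonneg hpq ha'
  have hprr := mul_nonneg hpr ha'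
  intro q hq
  simp only [Set.mem_insert_iff, Set.mem_singleton_iff] at hq
  rcases hq with rfl | rfl | rfl | rfl | rfl | rfl | rfl | rfl | rfl | rfl | rfl | rfl | rfl |
    rfl | rfl | rfl | rfl | rfl | rfl | rfl | rfl | rfl | rfl | rfl | rfl | rfl <;>
  exact dist_center_le ha (by linarith)
end

section
/- For all real a, b, c with 0 ≤ c ≤ b ≤ a ≤ 1/2, the point w = (1 − (a + 2c(1−c))/(3−2a), 1 − (b + 2c(1−c))/(3−2b), 1−c) in ℝ³ is equidistant from the four points p_U = (a, b, 3−c), p_B = (a, 3−b, c), p_D = (a, b, −1−c), p_R = (3−a, b, c). -/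
/-- A point `w` is equidistant from four points. -/
def Equidist4 (w p q r s : EuclideanSpace ℝ (Fin 3)) : Prop :=
  dist w p = dist w q ∧ dist w q = dist w r ∧ dist w r = dist w s

theorem dist_pt3_eq_dist_pt3_iff (x y z x₁ y₁ z₁ x₂ y₂ z₂ : ℝ) :
    dist (pt3 x y z) (pt3 x₁ y₁ z₁) = dist (pt3 x y z) (pt3 x₂ y₂ z₂) ↔
      (x - x₁) ^ 2 + (y - y₁) ^ 2 + (z - z₁) ^ 2 =
        (x - x₂) ^ 2 + (y - y₂) ^ 2 + (z - z₂) ^ 2 := by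
  rw [EuclideanSpace.dist_eq, EuclideanSpace.dist_eq,
    Real.sqrt_inj (by positivity) (by positivity)]
  simp [pt3, Fin.sum_univ_three, Real.dist_eq, sq_abs]

/-- The coordinate `1 - (t + 2c(1-c)) / (3 - 2t)` balances the squared distances to `t` and to its
reflection `3 - t` with the squared vertical offsets `2` and `1 - 2c`. -/
theorem sq_sub_add_sq_two_eq (t c : ℝ) (ht : 3 - 2 * t ≠ 0) :
    (1 - (t + 2 * c * (1 - c)) / (3 - 2 * t) - t) ^ 2 + 2 ^ 2 =
      (1 - (t + 2 * c * (1 - c)) / (3 - 2 * t) - (3 - t)) ^ 2 + (1 - 2 * c) ^ 2 := by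
  linear_combination -2 * div_mul_cancel₀ (t + 2 * c * (1 - c)) ht

/-- The circumcenter c(B,D,R) of the tetrahedron (p_U, p_B, p_D, p_R). -/
theorem circumcenter_BDR (a b c : ℝ) (hc : 0 ≤ c) (hcb : c ≤ b) (hba : b ≤ a)
    (ha : a ≤ 1 / 2) :
    Equidist4
      (pt3 (1 - (a + 2 * c * (1 - c)) / (3 - 2 * a))
        (1 - (b + 2 * c * (1 - c)) / (3 - 2 * b)) (1 - c))
      (pt3 a b (3 - c)) (pt3 a (3 - b) c) (pt3 a b (-1 - c)) (pt3 (3 - a) b c) := by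
  have hA := sq_sub_add_sq_two_eq a c (by linarith)
  have hB := sq_sub_add_sq_two_eq b c (by linarith)
  refine ⟨?_, ?_, ?_⟩ <;> rw [dist_pt3_eq_dist_pt3_iff] <;> linarith
end

section
/- Let 0 ≤ c ≤ b ≤ a ≤ 1/2 and set D = 3 − 4a + a² − c + c². Then the point w = (3/2 − (1−a+2c)(3−2c)/(2D), 3/2 − (3−2a)(1−a+2c)(3−2c)/(2(3−2b)D), 3/2 − (3−2a)(1−a+2c)/(2D)) in ℝ³ is equidistant from the four points p_U = (a, b, 3−c), p_B = (a, 3−b, c), p_RD = (2+c, b, −1+a), p_R = (3−a, b, c). -/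
/-- The circumcenter c(B,RD,R) of the tetrahedron (p_U, p_B, p_RD, p_R),
where D = 3 − 4a + a² − c + c². -/
theorem circumcenter_B_RD_R (a b c : ℝ) (hc : 0 ≤ c) (hcb : c ≤ b) (hba : b ≤ a)
    (ha : a ≤ 1 / 2) :
    Equidist4
      (pt3 (3 / 2 - (1 - a + 2 * c) * (3 - 2 * c) /
          (2 * (3 - 4 * a + a ^ 2 - c + c ^ 2)))
        (3 / 2 - (3 - 2 * a) * (1 - a + 2 * c) * (3 - 2 * c) /
          (2 * (3 - 2 * b) * (3 - 4 * a + a ^ 2 - c + c ^ 2)))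
        (3 / 2 - (3 - 2 * a) * (1 - a + 2 * c) /
          (2 * (3 - 4 * a + a ^ 2 - c + c ^ 2))))
      (pt3 a b (3 - c)) (pt3 a (3 - b) c) (pt3 (2 + c) b (-1 + a))
      (pt3 (3 - a) b c) := by
  have hD : 0 < 3 - 4 * a + a ^ 2 - c + c ^ 2 := by
    nlinarith [mul_nonneg (sub_nonneg.2 ha) (sub_nonneg.2 ha)]
  have hb : 0 < 3 - 2 * b := by linarith
  set D := 3 - 4 * a + a ^ 2 - c + c ^ 2 with hDdef
  obtain ⟨t, ht⟩ : ∃ t, t = (1 - a + 2 * c) / (2 * D) := ⟨_, rfl⟩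
  have hx : (1 - a + 2 * c) * (3 - 2 * c) / (2 * D) = (3 - 2 * c) * t := by
    rw [ht]; ring
  have hz : (3 - 2 * a) * (1 - a + 2 * c) / (2 * D) = (3 - 2 * a) * t := by
    rw [ht]; ring
  obtain ⟨y, hy⟩ : ∃ y, y =
      (3 - 2 * a) * (1 - a + 2 * c) * (3 - 2 * c) / (2 * (3 - 2 * b) * D) := ⟨_, rfl⟩
  have hy' : (3 - 2 * b) * y = (3 - 2 * a) * (3 - 2 * c) * t := by
    rw [hy, ht]; field_simp
  have ht' : 2 * D * t = 1 - a + 2 * c := by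
    rw [ht]; field_simp
  rw [hx, hz, ← hy]
  rw [hDdef] at ht'
  refine ⟨?_, ?_, ?_⟩ <;> rw [dist_pt3_eq_dist_pt3_iff]
  · linear_combination (-2) * hy'
  · linear_combination 2 * hy' + 2 * ht'
  · linear_combination (-2) * ht'
end

section
/- For points p_i = (x_i, y_i, z_i) in ℝ³, define outsphere(p₁,p₂,p₃,p₄,p₅) as the determinant of the 5×5 matrix whose i-th row is (x_i, y_i, z_i, 1, x_i² + y_i² + z_i²). Then for all real a, b, c: outsphere((a,b,3−c), (a,3−b,c), (a,2+c,−1+b), (2+c,b,−1+a), (3−a,b,c)) = 4(a−b)(3 − 3a − 3b − 17c + 3ab + 8ac + 8bc + c² − 4abc − 2ac² − 2bc² + 4c³). -/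
/-- The outsphere determinant of five points of ℝ³. -/
noncomputable def outsphere (p₁ p₂ p₃ p₄ p₅ : ℝ × ℝ × ℝ) : ℝ :=
  Matrix.det !![p₁.1, p₁.2.1, p₁.2.2, 1, p₁.1 ^ 2 + p₁.2.1 ^ 2 + p₁.2.2 ^ 2;
                p₂.1, p₂.2.1, p₂.2.2, 1, p₂.1 ^ 2 + p₂.2.1 ^ 2 + p₂.2.2 ^ 2;
                p₃.1, p₃.2.1, p₃.2.2, 1, p₃.1 ^ 2 + p₃.2.1 ^ 2 + p₃.2.2 ^ 2;
                p₄.1, p₄.2.1, p₄.2.2, 1, p₄.1 ^ 2 + p₄.2.1 ^ 2 + p₄.2.2 ^ 2;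
                p₅.1, p₅.2.1, p₅.2.2, 1, p₅.1 ^ 2 + p₅.2.1 ^ 2 + p₅.2.2 ^ 2]

/-- Closed-form evaluation of outsphere(p_U, p_B, p_BD, p_RD, p_R). -/
theorem outsphere_eval (a b c : ℝ) :
    outsphere (a, b, 3 - c) (a, 3 - b, c) (a, 2 + c, -1 + b) (2 + c, b, -1 + a)
        (3 - a, b, c) =
      4 * (a - b) *
        (3 - 3 * a - 3 * b - 17 * c + 3 * a * b + 8 * a * c + 8 * b * c + c ^ 2 -
          4 * a * b * c - 2 * a * c ^ 2 - 2 * b * c ^ 2 + 4 * c ^ 3) := by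
  simp [outsphere, Matrix.det_succ_row_zero, Fin.sum_univ_succ, Fin.succAbove]
  ring
end

section
/- Let 0 ≤ c < b ≤ a ≤ 1/2 and define the functions f_UB(x,y) = (−2+3b−c+(2−b−c)y)/(b−c), f_UR(x,y) = (−2+3a−c+(2−a−c)x)/(a−c), f_B(x,y) = (3b−3c+(3−2b)y)/(3−2c), f_BD(x,y) = (2+b−5c+(2−b+c)y)/(4−b−c), f_UBR(x,y) = (−4+3a+2b−c+(2−a−b)x+(2−b−c)y)/(a−c), f_BR(x,y) = (−2+3a+2b−3c+(2−a−b)x+(3−a−b)y)/(3−2c), f_BRD(x,y) = (a+2b−5c+(2−a−b)x+(2−b+c)y)/(4−a−c). Then for all (x,y) with a ≤ x < 1 and b ≤ y < 1: f_UBR(x,y) < max(f_UB(x,y), f_UR(x,y)), f_BR(x,y) < max(f_B(x,y), f_UR(x,y)), and f_BRD(x,y) < max(f_BD(x,y), f_UR(x,y)). -/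
/-- The bisector functions f_UBR, f_BR, f_BRD lie strictly below the maximum of
the bisector functions f_UB, f_UR, f_B, f_BD, f_UR on [a,1) × [b,1). -/
theorem bisector_envelope (a b c : ℝ) (hc : 0 ≤ c) (hcb : c < b) (hba : b ≤ a)
    (ha : a ≤ 1 / 2) (x y : ℝ) (hax : a ≤ x) (hx1 : x < 1) (hby : b ≤ y)
    (hy1 : y < 1) :
    (-4 + 3 * a + 2 * b - c + (2 - a - b) * x + (2 - b - c) * y) / (a - c) <
        max ((-2 + 3 * b - c + (2 - b - c) * y) / (b - c))
          ((-2 + 3 * a - c + (2 - a - c) * x) / (a - c)) ∧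
      (-2 + 3 * a + 2 * b - 3 * c + (2 - a - b) * x + (3 - a - b) * y) / (3 - 2 * c) <
        max ((3 * b - 3 * c + (3 - 2 * b) * y) / (3 - 2 * c))
          ((-2 + 3 * a - c + (2 - a - c) * x) / (a - c)) ∧
      (a + 2 * b - 5 * c + (2 - a - b) * x + (2 - b + c) * y) / (4 - a - c) <
        max ((2 + b - 5 * c + (2 - b + c) * y) / (4 - b - c))
          ((-2 + 3 * a - c + (2 - a - c) * x) / (a - c)) := by
  have hac : 0 < a - c := by linarith
  have hbc : 0 < b - c := by linarith
  have h3c : 0 < 3 - 2 * c := by linarith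
  have hDb : 0 < 4 - b - c := by linarith
  have hDa : 0 < 4 - a - c := by linarith
  refine ⟨?_, ?_, ?_⟩
  · by_contra! h
    obtain ⟨h1, h2⟩ := max_le_iff.mp h
    rw [div_le_div_iff₀ hbc hac] at h1
    rw [div_le_div_iff_of_pos_right hac] at h2
    have hUR : 0 < (1 - a) * (1 - x) := mul_pos (by linarith) (by linarith)
    have hUB : 0 ≤ (a - b) * (-2 + 3 * b - c + (2 - b - c) * y - (b - c) * (1 + x)) :=
      mul_nonneg (by linarith) (by linarith)
    nlinarith [mul_pos hbc hUR]
  · by_contra! h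
    obtain ⟨h1, h2⟩ := max_le_iff.mp h
    rw [div_le_div_iff_of_pos_right h3c] at h1
    rw [div_le_div_iff₀ hac h3c] at h2
    have hUR : 0 ≤ (3 - a - c) *
        (-2 + 3 * a - c + (2 - a - c) * x - (b - c) * (1 + x) - (a - b) * y) :=
      mul_nonneg (by linarith) (by linarith)
    have hxy : 0 < 3 - 3 * a + c + (3 - 2 * c) * x - (3 - 2 * a) * y := by
      nlinarith [mul_pos (show 0 < 3 - 2 * a by linarith) (sub_pos.mpr hy1),
        mul_nonneg h3c.le (sub_nonneg.mpr hax),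
        mul_nonneg (show 0 ≤ a by linarith) (show 0 ≤ 1 - c by linarith)]
    nlinarith [mul_pos hbc hxy]
  · by_contra! h
    obtain ⟨h1, h2⟩ := max_le_iff.mp h
    rw [div_le_div_iff₀ hDb hDa] at h1
    rw [div_le_div_iff₀ hac hDa] at h2
    have hy : 0 < (2 - b + c) * (1 - y) := mul_pos (by linarith) (by linarith)
    have hBD : (4 - b - c) * (2 - a - b) * (1 - x) ≤ (a - b) * (4 - 4 * c) := by
      nlinarith [mul_nonneg (sub_nonneg.mpr hba) hy.le]
    have hUR : (a - c) * (4 - 2 * a + 2 * c) <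
        ((2 - a - c) * (4 - a - c) - (2 - a - b) * (a - c)) * (1 - x) := by
      nlinarith [mul_pos hac hy]
    have hK : 0 < (2 - a - c) * (4 - a - c) - (2 - a - b) * (a - c) := by
      nlinarith
    have hM : 0 < (4 - b - c) * (2 - a - b) := mul_pos hDb (by linarith)
    have hprod : (2 - a - b) * (a - c) ≤ 4 * (1 - c) * (1 - a) := by
      nlinarith [mul_nonneg (show 0 ≤ 1 - 2 * a by linarith) (show 0 ≤ 1 - c by linarith)]
    have hQ : 0 ≤ 4 * (1 - c) * (1 - a) * (b - c) - (b - 3 * c) * ((2 - a - b) * (a - c)) := by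
      nlinarith [mul_nonneg hbc.le (sub_nonneg.mpr hprod),
        mul_nonneg hc (mul_nonneg (show 0 ≤ 2 - a - b by linarith) hac.le)]
    linarith [mul_le_mul_of_nonneg_left hBD hK.le, mul_lt_mul_of_pos_left hUR hM,
      mul_nonneg hDa.le hQ]
end

section
/- Let c, ξ be real numbers with 0 ≤ c ≤ 1/6 and c ≤ ξ ≤ 1/2. Then (ξ + 2c(1−c))/(3 − 2ξ) ≤ (2/3)(ξ − c) + c and (ξ + c)(1−c)/(2 − ξ + c) ≤ (2/3)(ξ − c) + c. -/
/-- The bounds φ_{1,c}(ξ) ≤ (2/3)(ξ−c)+c and φ_{2,c}(ξ) ≤ (2/3)(ξ−c)+c for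
0 ≤ c ≤ 1/6 and c ≤ ξ ≤ 1/2. -/
theorem phi_contraction (c ξ : ℝ) (hc : 0 ≤ c) (hc6 : c ≤ 1 / 6) (hcx : c ≤ ξ)
    (hx : ξ ≤ 1 / 2) :
    (ξ + 2 * c * (1 - c)) / (3 - 2 * ξ) ≤ 2 / 3 * (ξ - c) + c ∧
      (ξ + c) * (1 - c) / (2 - ξ + c) ≤ 2 / 3 * (ξ - c) + c := by
  have ht : 0 ≤ ξ - c := sub_nonneg.2 hcx
  constructor
  · rw [div_le_iff₀ (by linarith)]
    have h : 0 ≤ (ξ - c) * (1 - 2 * c - 4 / 3 * ξ) := mul_nonneg ht (by linarith)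
    linarith
  · rw [div_le_iff₀ (by linarith)]
    have h : 0 ≤ (ξ - c) * (1 - 2 * (ξ - c)) := mul_nonneg ht (by linarith)
    linarith [sq_nonneg c]
end
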